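/- For every half-integral vector y ∈ {0, 1/2, 1}^m, the matrix Z(y) is nonsingular (its determinant is a nonzero element of the rational function field) if and only if there exists a half-integral vector z ∈ {0, 1/2, 1}^m with z ≥ y (componentwise), |z| = n/2, such that the 2n×2n matrix B(z) is nonsingular. -/

import Mathlib

open Matrix

noncomputable section

/-- Wedge product `a ∧ b = a bᵀ − b aᵀ`. -/
def wedge {K : Type*} [Field K] {n : ℕ} (a b : Fin n → K) : Matrix (Fin n) (Fin n) K :=
  vecMulVec a b - vecMulVec b a

/-- The line spanned by `a` and `b`. -/
def line {K : Type*} [Field K] {n : ℕ} (a b : Fin n → K) : Submodule K (Fin n → K) :=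
  Submodule.span K {a, b}

/-- `y` is a fractional matroid matching for the lines `ℓᵢ = span {aᵢ, bᵢ}`. -/
def IsFracMatching {K : Type*} [Field K] {n m : ℕ} (a b : Fin m → Fin n → K)
    (y : Fin m → ℝ) : Prop :=
  (∀ i, 0 ≤ y i) ∧ ∀ S : Submodule K (Fin n → K),
    ∑ i, (Module.finrank K ↥(S ⊓ line (a i) (b i)) : ℝ) * y i ≤ (Module.finrank K ↥S : ℝ)

/-- The rational function field generated over `K` by the entries of the `2 × 2`
indeterminate matrices `U₁, …, U_m`. -/
abbrev FF2 (K : Type*) [Field K] (m : ℕ) : Type _ :=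
  FractionRing (MvPolynomial (Fin m × Fin 2 × Fin 2) K)

/-- The indeterminate `(Uᵢ)_{p,c}` as an element of `FF2 K m`. -/
def Uvar {K : Type*} [Field K] {m : ℕ} (i : Fin m) (p c : Fin 2) : FF2 K m :=
  algebraMap (MvPolynomial (Fin m × Fin 2 × Fin 2) K) (FF2 K m) (MvPolynomial.X (i, p, c))

def toFF2 (K : Type*) [Field K] (m : ℕ) : K →+* FF2 K m :=
  (algebraMap (MvPolynomial (Fin m × Fin 2 × Fin 2) K) (FF2 K m)).comp MvPolynomial.C

/-- The `n × 2` matrix `Bᵢ = [aᵢ bᵢ]`. -/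
def colMat {K : Type*} [Field K] {n : ℕ} (a b : Fin n → K) : Matrix (Fin n) (Fin 2) K :=
  Matrix.of fun r j => if j = 0 then a r else b r

/-- The matrix `B(z) = [U₁ ⊗ B₁ ⋯ U_m ⊗ B_m]`, where the half-integral vector `z` is
encoded by `s : Fin m → ℕ` with `sᵢ = 2 zᵢ ∈ {0, 1, 2}`, and `Uᵢ` is a `2 × sᵢ` matrix of
distinct indeterminates.  The unused columns (those with `c ≥ sᵢ`) are padded with zeros,
so that `B(z)` has full column rank iff this matrix has rank `∑ᵢ 2 sᵢ = 4|z|`. -/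
def Bmat {K : Type*} [Field K] {n m : ℕ} (a b : Fin m → Fin n → K) (s : Fin m → ℕ) :
    Matrix (Fin 2 × Fin n) (Fin m × Fin 2 × Fin 2) (FF2 K m) :=
  Matrix.of fun pr icj =>
    if (icj.2.1 : ℕ) < s icj.1 then
      Uvar icj.1 pr.1 icj.2.1 * toFF2 K m (colMat (a icj.1) (b icj.1) pr.2 icj.2.2)
    else 0

/-- The `2 × 2` matrix `Yᵢ = Uᵢ Uᵢᵀ`, where `Uᵢ` is a `2 × sᵢ` matrix of indeterminates. -/
def Ymat {K : Type*} [Field K] {m : ℕ} (s : Fin m → ℕ) (i : Fin m) :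
    Matrix (Fin 2) (Fin 2) (FF2 K m) :=
  Matrix.of fun p q => ∑ c : Fin 2, if (c : ℕ) < s i then Uvar i p c * Uvar i q c else 0

/-- The matrix `A^{(2)}(y) = ∑ᵢ (Uᵢ Uᵢᵀ) ⊗ (aᵢ ∧ bᵢ)`, where the half-integral vector `y`
is encoded by `t : Fin m → ℕ` with `tᵢ = 2 yᵢ ∈ {0, 1, 2}`. -/
def A2 {K : Type*} [Field K] {n m : ℕ} (a b : Fin m → Fin n → K) (t : Fin m → ℕ) :
    Matrix (Fin 2 × Fin n) (Fin 2 × Fin n) (FF2 K m) :=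
  ∑ i : Fin m,
    kroneckerMap (· * ·) (Ymat t i) ((wedge (a i) (b i)).map (toFF2 K m))
def Delta (K : Type*) [Field K] : Matrix (Fin 2) (Fin 2) K := !![0, 1; -1, 0]

/-- The matrix `Z(y)` (for the half-integral vector `y` encoded by `t : Fin m → ℕ` with
`tᵢ = 2 yᵢ`): top-left `2n × 2n` block zero, top-right blocks `I₂ ⊗ Bᵢ`, bottom-left
blocks `−(I₂ ⊗ Bᵢ)ᵀ`, bottom-right block `diag(Y₁ ⊗ Δ, …, Y_m ⊗ Δ)` with
`Yᵢ = Uᵢ Uᵢᵀ` for a `2 × 2(1 − yᵢ)` indeterminate matrix `Uᵢ`. -/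
def Zmat {K : Type*} [Field K] {n m : ℕ} (a b : Fin m → Fin n → K) (t : Fin m → ℕ) :
    Matrix ((Fin 2 × Fin n) ⊕ (Fin m × Fin 2 × Fin 2))
      ((Fin 2 × Fin n) ⊕ (Fin m × Fin 2 × Fin 2)) (FF2 K m) :=
  Matrix.of fun rr cc =>
    match rr, cc with
    | Sum.inl _, Sum.inl _ => 0
    | Sum.inl pr, Sum.inr icj =>
        if pr.1 = icj.2.1 then toFF2 K m (colMat (a icj.1) (b icj.1) pr.2 icj.2.2) else 0
    | Sum.inr icj, Sum.inl pr =>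
        -(if pr.1 = icj.2.1 then toFF2 K m (colMat (a icj.1) (b icj.1) pr.2 icj.2.2) else 0)
    | Sum.inr icj, Sum.inr icj' =>
        if icj.1 = icj'.1 then
          Ymat (fun k => 2 - t k) icj.1 icj.2.1 icj'.2.1 * toFF2 K m (Delta K icj.2.2 icj'.2.2)
        else 0

theorem exists_finset_dual_basis_of_nondegenerate {F ι : Type*} [Field F] [DecidableEq ι]
    (E : Finset ι) : ∀ {V : Type*} [AddCommGroup V] [Module F V] [FiniteDimensional F V]
    (α β : ι → V →ₗ[F] F),
    (∀ v, (∀ w, ∑ e ∈ E, (α e v * β e w - β e v * α e w) = 0) → v = 0) →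
    ∃ S ⊆ E, 2 * S.card = Module.finrank F V ∧
      ∀ v, (∀ e ∈ S, α e v = 0 ∧ β e v = 0) → v = 0 := by
  induction E using Finset.induction_on with
  | empty =>
    intro V _ _ _ α β h
    have h0 : ∀ v : V, v = 0 := fun v => h v (by simp)
    have : Subsingleton V := ⟨fun x y => by rw [h0 x, h0 y]⟩
    exact ⟨∅, subset_rfl, by simp [Module.finrank_zero_of_subsingleton], fun v _ => h0 v⟩
  | insert e E he ih =>
    intro V _ _ _ α β h
    simp only [Finset.sum_insert he] at h
    let A' : V →ₗ[F] V →ₗ[F] F :=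
      ∑ e ∈ E, ((α e).smulRight (β e) - (β e).smulRight (α e))
    have hA' : ∀ v w, A' v w = ∑ e ∈ E, (α e v * β e w - β e v * α e w) := by
      intro v w
      simp [A', LinearMap.sum_apply]
    let A : V →ₗ[F] V →ₗ[F] F := ((α e).smulRight (β e) - (β e).smulRight (α e)) + A'
    have hA : ∀ v w, A v w = α e v * β e w - β e v * α e w + A' v w := by
      intro v w
      simp [A]
    simp only [← hA', ← hA] at h
    have hA'swap : ∀ v w, A' v w = - A' w v := by
      intro v w
      rw [hA', hA', ← Finset.sum_neg_distrib]
      exact Finset.sum_congr rfl fun _ _ => by ring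
    have hA'self : ∀ v, A' v v = 0 := by
      intro v
      rw [hA']
      exact Finset.sum_eq_zero fun _ _ => by ring
    have hinj : Function.Injective A := by
      rw [injective_iff_map_eq_zero]
      intro v hv
      exact h v fun w => by rw [hv]; rfl
    have hsurj : Function.Surjective A :=
      (LinearMap.injective_iff_surjective_of_finrank_eq_finrank
        (Subspace.dual_finrank_eq (K := F) (V := V)).symm).1 hinj
    obtain ⟨x, hx⟩ := hsurj (α e)
    obtain ⟨y, hy⟩ := hsurj (β e)
    have hx' : ∀ w, A x w = α e w := fun w => by rw [hx]
    have hy' : ∀ w, A y w = β e w := fun w => by rw [hy]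
    have hαx : α e x = 0 := by rw [← hx', hA, hA'self]; ring
    have hβy : β e y = 0 := by rw [← hy', hA, hA'self]; ring
    have hαy : α e y = - β e x := by
      rw [← hx', ← hy', hA, hA, hA'swap]; ring
    have hA'x : ∀ w, A' x w = (1 + β e x) * α e w := fun w => by
      linear_combination hx' w - hA x w - hαx * β e w
    have hA'y : ∀ w, A' y w = (1 + β e x) * β e w := fun w => by
      linear_combination hy' w - hA y w + hβy * α e w - hαy * β e w
    by_cases hc : 1 + β e x = 0
    · let ψ : V →ₗ[F] F × F := (α e).prod (β e)
      have hβx : β e x = -1 := by linear_combination hc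
      rw [hβx, neg_neg] at hαy
      have hψ : Function.Surjective ψ := by
        rintro ⟨p, q⟩
        refine ⟨p • y - q • x, ?_⟩
        simp [ψ, hαx, hαy, hβx, hβy]
      have hrank := LinearMap.finrank_range_add_finrank_ker ψ
      rw [LinearMap.range_eq_top.2 hψ, finrank_top] at hrank
      simp only [Module.finrank_prod, Module.finrank_self] at hrank
      have hmem : ∀ v, v ∈ LinearMap.ker ψ ↔ α e v = 0 ∧ β e v = 0 := by
        intro v
        simp [ψ]
      obtain ⟨S, hSE, hcard, hS⟩ := ih (V := LinearMap.ker ψ)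
        (fun e => (α e).comp (LinearMap.ker ψ).subtype)
        (fun e => (β e).comp (LinearMap.ker ψ).subtype) (by
          rintro ⟨u, hu⟩ h0
          rw [Subtype.ext_iff]
          have hu' := (hmem u).1 hu
          refine h u fun w => ?_
          have hw : w - (α e w • y - β e w • x) ∈ LinearMap.ker ψ := by
            rw [hmem]
            simp [hαx, hαy, hβx, hβy]
          have h1 : A' u (w - (α e w • y - β e w • x)) = 0 := by
            rw [hA']
            exact h0 ⟨_, hw⟩
          have h2 : A' u x = 0 := by rw [hA'swap, hA'x, hc]; ring
          have h3 : A' u y = 0 := by rw [hA'swap, hA'y, hc]; ring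
          simp only [map_sub, map_smul, h2, h3, smul_zero, sub_zero] at h1
          rw [hA, hu'.1, hu'.2, h1]; ring)
      refine ⟨insert e S, Finset.insert_subset_insert _ hSE, ?_, ?_⟩
      · rw [Finset.card_insert_of_notMem fun h => he (hSE h)]
        omega
      · intro v hv
        have := hS ⟨v, (hmem v).2 (hv e (Finset.mem_insert_self _ _))⟩
          fun e' he' => hv e' (Finset.mem_insert_of_mem he')
        exact congrArg Subtype.val this
    · obtain ⟨S, hSE, hS⟩ := ih α β (by
        intro v hv
        simp only [← hA'] at hv
        have h1 : α e v = 0 := by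
          have := hA'x v
          rw [hA'swap, hv, neg_zero, eq_comm, mul_eq_zero] at this
          exact this.resolve_left hc
        have h2 : β e v = 0 := by
          have := hA'y v
          rw [hA'swap, hv, neg_zero, eq_comm, mul_eq_zero] at this
          exact this.resolve_left hc
        exact h v fun w => by rw [hA, h1, h2, hv]; ring)
      exact ⟨S, hSE.trans (Finset.subset_insert _ _), hS⟩

theorem rank_eq_card_iff_det_submatrix_ne_zero {F ι κ : Type*} [Field F] [Fintype ι]
    [DecidableEq ι] [Fintype κ] [DecidableEq κ] (M : Matrix ι κ F) {P : κ → Prop} [DecidablePred P]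
    (hM : ∀ i k, ¬ P k → M i k = 0) (e : ι ≃ {k // P k}) :
    M.rank = Fintype.card ι ↔ (M.submatrix id fun i => (e i : κ)).det ≠ 0 := by
  set N := M.submatrix id fun i => (e i : κ) with hN
  constructor
  · intro hr hdet
    have hfac : M = N * Matrix.of fun i k => if (e i : κ) = k then (1 : F) else 0 := by
      ext i k
      simp only [hN, Matrix.mul_apply, submatrix_apply, id, Matrix.of_apply, mul_ite, mul_one,
        mul_zero]
      by_cases hk : P k
      · rw [Finset.sum_eq_single (e.symm ⟨k, hk⟩)]
        · simp
        · intro j _ hj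
          rw [if_neg]
          rintro rfl
          exact hj (by simp)
        · simp
      · rw [hM i k hk, eq_comm]
        refine Finset.sum_eq_zero fun j _ => ?_
        rw [if_neg]
        rintro rfl
        exact hk (e j).2
    have hle : Fintype.card ι ≤ N.rank := by
      rw [← hr, hfac]
      exact rank_mul_le_left _ _
    have hsurj : Function.Surjective N.mulVecLin := by
      rw [← LinearMap.range_eq_top]
      apply Submodule.eq_top_of_finrank_eq
      rw [Module.finrank_fintype_fun_eq_card]
      exact le_antisymm N.rank_le_card_width hle
    have hinj := LinearMap.injective_iff_surjective.2 hsurj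
    obtain ⟨v, hv, hv0⟩ := exists_mulVec_eq_zero_iff.2 hdet
    exact hv (hinj (by simpa using hv0))
  · intro hdet
    refine le_antisymm M.rank_le_card_height ?_
    rw [← rank_of_isUnit N ((isUnit_iff_isUnit_det N).2 hdet.isUnit)]
    exact rank_submatrix_le _ _ _

theorem det_submatrix_ne_zero_iff_forall_supported {F ι κ : Type*} [Field F] [Fintype ι]
    [DecidableEq ι] [Fintype κ] (M : Matrix ι κ F) {P : κ → Prop} [DecidablePred P]
    (e : ι ≃ {k // P k}) :
    (M.submatrix id fun i => (e i : κ)).det ≠ 0 ↔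
      ∀ v : κ → F, (∀ k, ¬ P k → v k = 0) → M *ᵥ v = 0 → v = 0 := by
  have key : ∀ v : κ → F, (∀ k, ¬ P k → v k = 0) →
      (M.submatrix id fun i => (e i : κ)) *ᵥ (fun i => v (e i)) = M *ᵥ v := by
    intro v hv
    ext i
    simp only [mulVec, dotProduct, submatrix_apply, id]
    rw [Equiv.sum_comp e fun k : {k // P k} => M i k * v k,
      ← Finset.sum_subtype (Finset.univ.filter P) (by simp) fun k => M i k * v k]
    refine Finset.sum_filter_of_ne fun k _ hk => ?_
    contrapose! hk
    rw [hv k hk, mul_zero]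
  rw [← not_iff_not, not_not, ← exists_mulVec_eq_zero_iff]
  push Not
  constructor
  · rintro ⟨w, hw, hw0⟩
    let v : κ → F := fun k => if h : P k then w (e.symm ⟨k, h⟩) else 0
    have hv : ∀ k, ¬ P k → v k = 0 := fun k hk => dif_neg hk
    have hvw : (fun i => v (e i)) = w := by
      ext i
      simp [v, (e i).2]
    refine ⟨v, hv, ?_, ?_⟩
    · rw [← key v hv, hvw, hw0]
    · rintro h
      apply hw
      rw [← hvw, h]
      rfl
  · rintro ⟨v, hv, hv0, hne⟩
    refine ⟨fun i => v (e i), fun h => hne ?_, by rw [key v hv, hv0]⟩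
    ext k
    by_cases hk : P k
    · simpa using congrFun h (e.symm ⟨k, hk⟩)
    · exact hv k hk

theorem det_map_algebraMap_ne_zero {R L ι : Type*} [CommRing R] [IsDomain R] [CommRing L]
    [Fintype ι] [DecidableEq ι] (M : Matrix ι ι R) (φ : R →+* L) (h : (M.map φ).det ≠ 0) :
    (M.map (algebraMap R (FractionRing R))).det ≠ 0 := by
  have h1 := φ.map_det M
  have h2 := (algebraMap R (FractionRing R)).map_det M
  rw [RingHom.mapMatrix_apply] at h1 h2
  rw [← h2]
  rw [← h1] at h
  intro h0
  rw [map_eq_zero_iff _ (IsFractionRing.injective R _)] at h0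
  exact h (by rw [h0, map_zero])

theorem exists_smul_of_dot_eq_zero {F : Type*} [Field F] {u v : Fin 2 → F} (hu : u ≠ 0)
    (h : ∑ p, u p * v p = 0) : ∃ r : F, v 0 = -u 1 * r ∧ v 1 = u 0 * r := by
  rw [Fin.sum_univ_two] at h
  by_cases h0 : u 0 = 0
  · have h1 : u 1 ≠ 0 := fun h1 => hu (by ext p; fin_cases p <;> simp [h0, h1])
    refine ⟨-v 0 / u 1, ?_, ?_⟩
    · field_simp
    · have : v 1 = 0 := by simpa [h0, h1] using h
      simp [h0, this]
  · refine ⟨v 1 / u 0, ?_, ?_⟩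
    · field_simp
      linear_combination h
    · field_simp

theorem card_columns {m : ℕ} (s : Fin m → ℕ) (hs : ∀ i, s i ≤ 2) :
    Fintype.card {x : Fin m × Fin 2 × Fin 2 // (x.2.1 : ℕ) < s x.1} = 2 * ∑ i, s i := by
  rw [Fintype.card_subtype, Finset.card_filter, Fintype.sum_prod_type, Finset.mul_sum]
  refine Finset.sum_congr rfl fun i _ => ?_
  rw [Fintype.sum_prod_type]
  have h : s i = 0 ∨ s i = 1 ∨ s i = 2 := by
    have := hs i
    omega
  rcases h with h | h | h <;> simp [h]

/-- The block row `[I₂ ⊗ B₁ ⋯ I₂ ⊗ B_m]`, with scalars mapped along `f`. -/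
def blockRow {K R : Type*} [Field K] [CommRing R] (f : K →+* R) {n m : ℕ}
    (a b : Fin m → Fin n → K) : Matrix (Fin 2 × Fin n) (Fin m × Fin 2 × Fin 2) R :=
  Matrix.of fun pr icj =>
    if pr.1 = icj.2.1 then f (colMat (a icj.1) (b icj.1) pr.2 icj.2.2) else 0

/-- The block diagonal matrix with blocks `(Uᵢ Uᵢᵀ) ⊗ Δ`, where `Uᵢ` consists of the first
`2 - tᵢ` columns of `u i`. -/
def skewDiag {K R : Type*} [Field K] [CommRing R] (f : K →+* R) {m : ℕ}
    (u : Fin m → Fin 2 → Fin 2 → R) (t : Fin m → ℕ) :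
    Matrix (Fin m × Fin 2 × Fin 2) (Fin m × Fin 2 × Fin 2) R :=
  Matrix.of fun x y =>
    if x.1 = y.1 then
      (∑ c : Fin 2, if (c : ℕ) < 2 - t x.1 then u x.1 x.2.1 c * u x.1 y.2.1 c else 0) *
        f (Delta K x.2.2 y.2.2)
    else 0

/-- The matrix `Z(y)` with the entries of the matrices `Uᵢ` taken from `u`. -/
def specialZ {K R : Type*} [Field K] [CommRing R] (f : K →+* R) {n m : ℕ}
    (u : Fin m → Fin 2 → Fin 2 → R) (a b : Fin m → Fin n → K) (t : Fin m → ℕ) :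
    Matrix ((Fin 2 × Fin n) ⊕ (Fin m × Fin 2 × Fin 2))
      ((Fin 2 × Fin n) ⊕ (Fin m × Fin 2 × Fin 2)) R :=
  fromBlocks 0 (blockRow f a b) (-(blockRow f a b)ᵀ) (skewDiag f u t)

/-- The matrix `B(z)` with the entries of the matrices `Uᵢ` taken from `u`. -/
def specialB {K R : Type*} [Field K] [CommRing R] (f : K →+* R) {n m : ℕ}
    (u : Fin m → Fin 2 → Fin 2 → R) (a b : Fin m → Fin n → K) (s : Fin m → ℕ) :
    Matrix (Fin 2 × Fin n) (Fin m × Fin 2 × Fin 2) R :=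
  Matrix.of fun pr icj =>
    if (icj.2.1 : ℕ) < s icj.1 then
      u icj.1 pr.1 icj.2.1 * f (colMat (a icj.1) (b icj.1) pr.2 icj.2.2)
    else 0

theorem Zmat_eq_specialZ {K : Type*} [Field K] {n m : ℕ} (a b : Fin m → Fin n → K)
    (t : Fin m → ℕ) : Zmat a b t = specialZ (toFF2 K m) Uvar a b t := by
  ext (x | x) (y | y) <;> rfl

theorem Bmat_eq_specialB {K : Type*} [Field K] {n m : ℕ} (a b : Fin m → Fin n → K)
    (s : Fin m → ℕ) : Bmat a b s = specialB (toFF2 K m) Uvar a b s := rfl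

theorem specialZ_map {K R L : Type*} [Field K] [CommRing R] [CommRing L] (f : K →+* R)
    (φ : R →+* L) {n m : ℕ} (u : Fin m → Fin 2 → Fin 2 → R) (a b : Fin m → Fin n → K)
    (t : Fin m → ℕ) :
    (specialZ f u a b t).map φ = specialZ (φ.comp f) (fun i p c => φ (u i p c)) a b t := by
  ext (x | x) (y | y) <;>
    simp [specialZ, blockRow, skewDiag, apply_ite φ]

theorem specialB_map {K R L : Type*} [Field K] [CommRing R] [CommRing L] (f : K →+* R)
    (φ : R →+* L) {n m : ℕ} (u : Fin m → Fin 2 → Fin 2 → R) (a b : Fin m → Fin n → K)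
    (s : Fin m → ℕ) :
    (specialB f u a b s).map φ = specialB (φ.comp f) (fun i p c => φ (u i p c)) a b s := by
  ext x y
  simp [specialB, apply_ite φ]

theorem det_Zmat_ne_zero_of_specialization {K : Type*} [Field K] {n m : ℕ}
    (a b : Fin m → Fin n → K) (t : Fin m → ℕ) (u : Fin m → Fin 2 → Fin 2 → FF2 K m)
    (h : (specialZ (toFF2 K m) u a b t).det ≠ 0) : (Zmat a b t).det ≠ 0 := by
  let φ : MvPolynomial (Fin m × Fin 2 × Fin 2) K →+* FF2 K m :=
    MvPolynomial.eval₂Hom (toFF2 K m) fun x => u x.1 x.2.1 x.2.2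
  have := det_map_algebraMap_ne_zero
    (specialZ MvPolynomial.C (fun i p c => MvPolynomial.X (i, p, c)) a b t) φ (by
      rw [specialZ_map]
      convert h using 3
      · ext x
        simp [φ]
      · simp [φ])
  rw [specialZ_map] at this
  rw [Zmat_eq_specialZ]
  exact this

theorem det_Bmat_submatrix_ne_zero_of_specialization {K ι : Type*} [Field K] [Fintype ι]
    [DecidableEq ι] {n m : ℕ} (a b : Fin m → Fin n → K) (s : Fin m → ℕ)
    (u : Fin m → Fin 2 → Fin 2 → FF2 K m) (r : ι → Fin 2 × Fin n)
    (g : ι → Fin m × Fin 2 × Fin 2)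
    (h : ((specialB (toFF2 K m) u a b s).submatrix r g).det ≠ 0) :
    ((Bmat a b s).submatrix r g).det ≠ 0 := by
  let φ : MvPolynomial (Fin m × Fin 2 × Fin 2) K →+* FF2 K m :=
    MvPolynomial.eval₂Hom (toFF2 K m) fun x => u x.1 x.2.1 x.2.2
  have := det_map_algebraMap_ne_zero
    ((specialB MvPolynomial.C (fun i p c => MvPolynomial.X (i, p, c)) a b s).submatrix r g) φ (by
      rw [← submatrix_map, specialB_map]
      convert h using 4
      · ext x
        simp [φ]
      · simp [φ])
  rwa [← submatrix_map, specialB_map] at this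

theorem det_Uvar_ne_zero {K : Type*} [Field K] {m : ℕ} (i : Fin m) :
    (Uvar i 0 0 * Uvar i 1 1 - Uvar i 0 1 * Uvar i 1 0 : FF2 K m) ≠ 0 := by
  simp only [Uvar, ← map_mul, ← map_sub]
  rw [Ne, map_eq_zero_iff _ (IsFractionRing.injective _ _)]
  intro h
  have := congrArg (MvPolynomial.eval fun x : Fin m × Fin 2 × Fin 2 =>
    if x.2.1 = x.2.2 then (1 : K) else 0) h
  simp at this

/-- The contraction of the block indexed by `e.1` of a vector with column `e.2` of `u e.1`. -/
def contract {F : Type*} [Field F] {m : ℕ} (u : Fin m → Fin 2 → Fin 2 → F) (j : Fin 2)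
    (e : Fin m × Fin 2) : (Fin m × Fin 2 × Fin 2 → F) →ₗ[F] F :=
  ∑ p, u e.1 p e.2 • LinearMap.proj (e.1, p, j)

theorem contract_apply {F : Type*} [Field F] {m : ℕ} (u : Fin m → Fin 2 → Fin 2 → F) (j : Fin 2)
    (e : Fin m × Fin 2) (v : Fin m × Fin 2 × Fin 2 → F) :
    contract u j e v = ∑ p, u e.1 p e.2 * v (e.1, p, j) := by
  simp [contract]

theorem dotProduct_skewDiag_mulVec {K F : Type*} [Field K] [Field F] (f : K →+* F) {m : ℕ}
    (u : Fin m → Fin 2 → Fin 2 → F) (t : Fin m → ℕ) (v w : Fin m × Fin 2 × Fin 2 → F) :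
    v ⬝ᵥ (skewDiag f u t *ᵥ w) =
      ∑ e : Fin m × Fin 2 with (e.2 : ℕ) < 2 - t e.1,
        (contract u 0 e v * contract u 1 e w - contract u 1 e v * contract u 0 e w) := by
  rw [Finset.sum_filter, Fintype.sum_prod_type]
  simp only [dotProduct, mulVec, Fintype.sum_prod_type, skewDiag, Matrix.of_apply, ite_mul,
    zero_mul]
  refine Finset.sum_congr rfl fun i _ => ?_
  simp only [Fin.sum_univ_two, contract_apply, Finset.sum_add_distrib, Finset.sum_ite_eq,
    Finset.mem_univ, if_true, Delta]
  simp
  split_ifs <;> ring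

theorem specialZ_mulVec {K F : Type*} [Field K] [Field F] (f : K →+* F) {n m : ℕ}
    (u : Fin m → Fin 2 → Fin 2 → F) (a b : Fin m → Fin n → K) (t : Fin m → ℕ)
    (p : Fin 2 × Fin n → F) (q : Fin m × Fin 2 × Fin 2 → F) :
    specialZ f u a b t *ᵥ Sum.elim p q =
      Sum.elim (blockRow f a b *ᵥ q) (skewDiag f u t *ᵥ q - p ᵥ* blockRow f a b) := by
  rw [specialZ, fromBlocks_mulVec]
  simp [neg_mulVec, mulVec_transpose, sub_eq_neg_add]

theorem exists_injective_of_det_specialZ_ne_zero {K F : Type*} [Field K] [Field F] (f : K →+* F)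
    {n m : ℕ} (u : Fin m → Fin 2 → Fin 2 → F) (a b : Fin m → Fin n → K) (t : Fin m → ℕ)
    (h : (specialZ f u a b t).det ≠ 0) :
    ∃ S : Finset (Fin m × Fin 2), (∀ e ∈ S, (e.2 : ℕ) < 2 - t e.1) ∧ S.card + n = 2 * m ∧
      ∀ v, blockRow f a b *ᵥ v = 0 → (∀ e ∈ S, ∀ j, contract u j e v = 0) → v = 0 := by
  have hsurj : ∀ p q, ∃ v w, blockRow f a b *ᵥ w = p ∧
      skewDiag f u t *ᵥ w - v ᵥ* blockRow f a b = q := by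
    intro p q
    have hu := (isUnit_iff_isUnit_det _).2 h.isUnit
    obtain ⟨x, hx⟩ := (mulVec_surjective_iff_isUnit.2 hu) (Sum.elim p q)
    refine ⟨x ∘ Sum.inl, x ∘ Sum.inr, ?_⟩
    rw [← Sum.elim_comp_inl_inr x, specialZ_mulVec] at hx
    exact ⟨congrArg (· ∘ Sum.inl) hx, congrArg (· ∘ Sum.inr) hx⟩
  let B := (blockRow f a b).mulVecLin
  obtain ⟨S, hSE, hcard, hS⟩ := exists_finset_dual_basis_of_nondegenerate
    (Finset.univ.filter fun e : Fin m × Fin 2 => (e.2 : ℕ) < 2 - t e.1)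
    (fun e => (contract u 0 e).comp (LinearMap.ker B).subtype)
    (fun e => (contract u 1 e).comp (LinearMap.ker B).subtype) (by
      rintro ⟨v, hv⟩ h0
      have hBv : blockRow f a b *ᵥ v = 0 := by simpa [B] using hv
      rw [Subtype.ext_iff]
      refine dotProduct_eq_zero _ fun g => ?_
      obtain ⟨p, w, hw, rfl⟩ := hsurj 0 g
      have h1 := h0 ⟨w, by simpa [B] using hw⟩
      have h2 := dotProduct_skewDiag_mulVec f u t v w
      rw [dotProduct_sub, h2, dotProduct_comm v, ← dotProduct_mulVec, hBv, dotProduct_zero,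
        sub_zero]
      exact h1)
  have hBsurj : Function.Surjective B := fun p => by
    obtain ⟨_, w, hw, _⟩ := hsurj p 0
    exact ⟨w, hw⟩
  have hrank := LinearMap.finrank_range_add_finrank_ker B
  rw [LinearMap.range_eq_top.2 hBsurj, finrank_top, ← hcard] at hrank
  simp only [Module.finrank_fintype_fun_eq_card, Fintype.card_prod, Fintype.card_fin] at hrank
  refine ⟨S, fun e he => (Finset.mem_filter.1 (hSE he)).2, by omega, fun v hv hve => ?_⟩
  exact congrArg Subtype.val (hS ⟨v, by simpa [B] using hv⟩ fun e he => ⟨hve e he 0, hve e he 1⟩)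

theorem det_specialZ_ne_zero_of_injective {K F : Type*} [Field K] [Field F] (f : K →+* F)
    {n m : ℕ} (u : Fin m → Fin 2 → Fin 2 → F) (a b : Fin m → Fin n → K) (t : Fin m → ℕ)
    (S : Finset (Fin m × Fin 2)) (hSt : ∀ e ∈ S, (e.2 : ℕ) < 2 - t e.1)
    (hu : ∀ i p c, (i, c) ∉ S → u i p c = 0) (hcard : S.card + n = 2 * m)
    (hS : ∀ v, blockRow f a b *ᵥ v = 0 → (∀ e ∈ S, ∀ j, contract u j e v = 0) → v = 0) :
    (specialZ f u a b t).det ≠ 0 := by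
  let M : (Fin m × Fin 2 × Fin 2 → F) →ₗ[F] (Fin 2 × Fin n → F) × (S × Fin 2 → F) :=
    (blockRow f a b).mulVecLin.prod (LinearMap.pi fun e => contract u e.2 e.1)
  have hMsurj : Function.Surjective M := by
    refine (LinearMap.injective_iff_surjective_of_finrank_eq_finrank ?_).1 ?_
    · simp only [Module.finrank_prod, Module.finrank_fintype_fun_eq_card, Fintype.card_prod,
        Fintype.card_fin, Fintype.card_coe]
      omega
    · rw [injective_iff_map_eq_zero]
      intro v hv
      have h1 : blockRow f a b *ᵥ v = 0 := congrArg Prod.fst hv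
      exact hS v h1 fun e he j => congrFun (congrArg Prod.snd hv) (⟨e, he⟩, j)
  have hM : ∀ (g : Fin 2 × Fin n → F) (k : S → Fin 2 → F), ∃ w, blockRow f a b *ᵥ w = g ∧ ∀ e : S, ∀ j, contract u j e w = k e j := by
    intro g k
    obtain ⟨w, hw⟩ := hMsurj (g, fun e => k e.1 e.2)
    exact ⟨w, congrArg Prod.fst hw, fun e j => congrFun (congrArg Prod.snd hw) (e, j)⟩
  intro hdet
  obtain ⟨x, hx, hx0⟩ := exists_mulVec_eq_zero_iff.2 hdet
  apply hx
  rw [← Sum.elim_comp_inl_inr x] at hx0 ⊢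
  generalize x ∘ Sum.inl = p at hx0 ⊢
  generalize x ∘ Sum.inr = q at hx0 ⊢
  rw [specialZ_mulVec] at hx0
  have hBq : blockRow f a b *ᵥ q = 0 := congrArg (· ∘ Sum.inl) hx0
  have hDq : skewDiag f u t *ᵥ q - p ᵥ* blockRow f a b = 0 := congrArg (· ∘ Sum.inr) hx0
  rw [sub_eq_zero] at hDq
  have hform : ∀ w, w ⬝ᵥ (skewDiag f u t *ᵥ q) =
      ∑ e ∈ S, (contract u 0 e w * contract u 1 e q - contract u 1 e w * contract u 0 e q) := by
    intro w
    rw [dotProduct_skewDiag_mulVec]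
    refine (Finset.sum_subset (fun e he => by simpa using hSt e he) fun e _ he => ?_).symm
    simp [contract_apply, hu e.1 _ e.2 he]
  have hpair : ∀ w, w ⬝ᵥ (skewDiag f u t *ᵥ q) = p ⬝ᵥ (blockRow f a b *ᵥ w) := by
    intro w
    rw [hDq, dotProduct_comm, dotProduct_mulVec]
  have hq : q = 0 := by
    refine hS q hBq fun e he j => ?_
    obtain ⟨w, hw, hwe⟩ := hM 0 fun e' j' => if e' = ⟨e, he⟩ ∧ j' ≠ j then 1 else 0
    have h1 := hpair w
    rw [hw, dotProduct_zero, hform, ← Finset.sum_coe_sort] at h1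
    simp only [hwe] at h1
    rw [Finset.sum_eq_single ⟨e, he⟩] at h1
    · fin_cases j <;> simpa using h1
    · intro e' _ hne
      simp [hne]
    · simp
  subst hq
  have hp : p = 0 := by
    refine dotProduct_eq_zero _ fun g => ?_
    obtain ⟨w, rfl, -⟩ := hM g 0
    rw [← hpair, mulVec_zero, dotProduct_zero]
  rw [hp]
  ext (_ | _) <;> rfl

/-- Placing combinations of the first `sᵢ` columns of the matrices `g i` into the blocks. -/
def expand {F : Type*} [Field F] {m : ℕ} (g : Fin m → Fin 2 → Fin 2 → F) (s : Fin m → ℕ)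
    (l : Fin m × Fin 2 × Fin 2 → F) : Fin m × Fin 2 × Fin 2 → F :=
  fun x => ∑ c : Fin 2, if (c : ℕ) < s x.1 then g x.1 x.2.1 c * l (x.1, c, x.2.2) else 0

theorem specialB_mulVec {K F : Type*} [Field K] [Field F] (f : K →+* F) {n m : ℕ}
    (g : Fin m → Fin 2 → Fin 2 → F) (a b : Fin m → Fin n → K) (s : Fin m → ℕ)
    (l : Fin m × Fin 2 × Fin 2 → F) :
    specialB f g a b s *ᵥ l = blockRow f a b *ᵥ expand g s l := by
  ext ⟨r, ρ⟩
  simp only [mulVec, dotProduct, Fintype.sum_prod_type, specialB, blockRow, Matrix.of_apply]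
  refine Finset.sum_congr rfl fun i _ => ?_
  fin_cases r <;> simp [expand, Fin.sum_univ_two] <;> split_ifs <;> ring

/-- The first `k` columns of `g` form a basis of the orthogonal complement of the columns of `u`
selected by `T`. -/
structure IsComplementary {F : Type*} [Field F] (u g : Fin 2 → Fin 2 → F) (T : Finset (Fin 2))
    (k : ℕ) : Prop where
  orthogonal : ∀ c ∈ T, ∀ c' : Fin 2, (c' : ℕ) < k → ∑ p, u p c * g p c' = 0
  independent : ∀ l : Fin 2 → F,
    (∀ p, (∑ c : Fin 2, if (c : ℕ) < k then g p c * l c else 0) = 0) →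
      ∀ c : Fin 2, (c : ℕ) < k → l c = 0
  spanning : ∀ v : Fin 2 → F, (∀ c ∈ T, ∑ p, u p c * v p = 0) →
    ∃ l : Fin 2 → F, (∀ c : Fin 2, ¬ (c : ℕ) < k → l c = 0) ∧
      ∀ p, v p = ∑ c : Fin 2, if (c : ℕ) < k then g p c * l c else 0

theorem injective_iff_of_isComplementary {K F : Type*} [Field K] [Field F] (f : K →+* F) {n m : ℕ}
    {u g : Fin m → Fin 2 → Fin 2 → F} {S : Finset (Fin m × Fin 2)} {s : Fin m → ℕ}
    {T : Fin m → Finset (Fin 2)} (hT : ∀ i c, (i, c) ∈ S ↔ c ∈ T i)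
    (h : ∀ i, IsComplementary (u i) (g i) (T i) (s i)) (a b : Fin m → Fin n → K) :
    (∀ v, blockRow f a b *ᵥ v = 0 → (∀ e ∈ S, ∀ j, contract u j e v = 0) → v = 0) ↔
      ∀ l : Fin m × Fin 2 × Fin 2 → F, (∀ x, ¬ (x.2.1 : ℕ) < s x.1 → l x = 0) →
        specialB f g a b s *ᵥ l = 0 → l = 0 := by
  constructor
  · intro hS l hl hBl
    rw [specialB_mulVec] at hBl
    have h0 := hS _ hBl (by
      rintro ⟨i, c⟩ he j
      simp only [contract_apply, expand, Finset.mul_sum]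
      rw [Finset.sum_comm]
      refine Finset.sum_eq_zero fun c' _ => ?_
      split_ifs with hc'
      · simp only [← mul_assoc, ← Finset.sum_mul]
        rw [(h i).orthogonal c ((hT i c).1 he) c' hc', zero_mul]
      · simp)
    ext ⟨i, c, j⟩
    by_cases hc : (c : ℕ) < s i
    · exact (h i).independent (fun c => l (i, c, j)) (fun p => congrFun h0 (i, p, j)) c hc
    · exact hl _ hc
  · intro hB v hv hSv
    have hex : ∀ i j, ∃ l : Fin 2 → F, (∀ c : Fin 2, ¬ (c : ℕ) < s i → l c = 0) ∧
        ∀ p, v (i, p, j) = ∑ c : Fin 2, if (c : ℕ) < s i then g i p c * l c else 0 :=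
      fun i j => (h i).spanning (fun p => v (i, p, j)) fun c hc => by
        rw [← contract_apply u j (i, c)]
        exact hSv _ ((hT i c).2 hc) j
    choose l hl hlv using hex
    have hv' : v = expand g s fun x => l x.1 x.2.2 x.2.1 := by
      ext ⟨i, p, j⟩
      exact hlv i j p
    have h0 := hB (fun x => l x.1 x.2.2 x.2.1) (fun x hx => hl _ _ _ hx) (by
      rw [specialB_mulVec, ← hv', hv])
    rw [hv', h0]
    ext x
    simp [expand]

theorem isComplementary_empty {F : Type*} [Field F] (u g : Fin 2 → Fin 2 → F)
    (hg : g 0 0 * g 1 1 - g 0 1 * g 1 0 ≠ 0) : IsComplementary u g ∅ 2 where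
  orthogonal := by simp
  independent l hl c _ := by
    have h0 := hl 0
    have h1 := hl 1
    simp only [Fin.sum_univ_two, Fin.is_lt, if_true] at h0 h1
    refine (mul_eq_zero.1 ?_).resolve_left hg
    fin_cases c <;> simp only [Fin.zero_eta, Fin.mk_one]
    · linear_combination g 1 1 * h0 - g 0 1 * h1
    · linear_combination g 0 0 * h1 - g 1 0 * h0
  spanning v _ := by
    refine ⟨![(g 1 1 * v 0 - g 0 1 * v 1) / (g 0 0 * g 1 1 - g 0 1 * g 1 0),
      (g 0 0 * v 1 - g 1 0 * v 0) / (g 0 0 * g 1 1 - g 0 1 * g 1 0)],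
      fun c hc => absurd c.is_lt hc, fun p => ?_⟩
    simp only [Fin.sum_univ_two, Fin.is_lt, if_true, Matrix.cons_val_zero, Matrix.cons_val_one]
    rw [← mul_div_assoc, ← mul_div_assoc, ← add_div, eq_div_iff hg]
    fin_cases p <;> simp <;> ring

theorem isComplementary_singleton {F : Type*} [Field F] (u g : Fin 2 → Fin 2 → F) (c : Fin 2)
    (hu : (u · c) ≠ 0) (hg : (g · 0) ≠ 0) (hug : ∑ p, u p c * g p 0 = 0) :
    IsComplementary u g {c} 1 where
  orthogonal c₁ h₁ c' hc' := by
    rw [Finset.mem_singleton.1 h₁, show c' = 0 by ext; simpa using hc', hug]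
  independent l hl c' hc' := by
    rw [show c' = 0 by ext; simpa using hc']
    by_contra hne
    apply hg
    ext p
    simpa [hne] using hl p
  spanning v hv := by
    obtain ⟨r, h0, h1⟩ := exists_smul_of_dot_eq_zero hu hug
    obtain ⟨r', h0', h1'⟩ := exists_smul_of_dot_eq_zero hu (hv c (Finset.mem_singleton_self c))
    have hr : r ≠ 0 := by
      rintro rfl
      apply hg
      ext p
      fin_cases p
      · simpa using h0
      · simpa using h1
    refine ⟨![r' / r, 0], fun c' hc' => ?_, fun p => ?_⟩
    · fin_cases c'
      · simp at hc'
      · rfl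
    · fin_cases p
      · simp [h0, h0']
        field_simp
      · simp [h1, h1']
        field_simp

theorem isComplementary_univ {F : Type*} [Field F] (u g : Fin 2 → Fin 2 → F)
    (hu : u 0 0 * u 1 1 - u 0 1 * u 1 0 ≠ 0) : IsComplementary u g Finset.univ 0 where
  orthogonal := by simp
  independent := by simp
  spanning v hv := by
    refine ⟨0, by simp, fun p => ?_⟩
    have h0 := hv 0 (Finset.mem_univ _)
    have h1 := hv 1 (Finset.mem_univ _)
    simp only [Fin.sum_univ_two] at h0 h1
    simp only [not_lt_zero, if_false, Finset.sum_const_zero]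
    refine (mul_eq_zero.1 ?_).resolve_left hu
    fin_cases p <;> simp only [Fin.zero_eta, Fin.mk_one]
    · linear_combination u 1 1 * h0 - u 1 0 * h1
    · linear_combination u 0 0 * h1 - u 0 1 * h0

theorem col_ne_zero_of_det_ne_zero {F : Type*} [Field F] {w : Fin 2 → Fin 2 → F}
    (hw : w 0 0 * w 1 1 - w 0 1 * w 1 0 ≠ 0) (c : Fin 2) : (w · c) ≠ 0 := by
  intro h
  apply hw
  have h0 : w 0 c = 0 := congrFun h 0
  have h1 : w 1 c = 0 := congrFun h 1
  fin_cases c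
  · simp at h0 h1
    simp [h0, h1]
  · simp at h0 h1
    simp [h0, h1]

theorem exists_perp {F : Type*} [Field F] {w : Fin 2 → F} (hw : w ≠ 0) :
    ∃ w' : Fin 2 → F, w' ≠ 0 ∧ ∑ p, w p * w' p = 0 := by
  refine ⟨![-w 1, w 0], fun h => hw ?_, by simp [Fin.sum_univ_two]; ring⟩
  ext p
  fin_cases p
  · simpa using congrFun h 1
  · simpa using congrFun h 0

theorem exists_isComplementary_right {F : Type*} [Field F] (u : Fin 2 → Fin 2 → F)
    (hu : u 0 0 * u 1 1 - u 0 1 * u 1 0 ≠ 0) (T : Finset (Fin 2)) :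
    ∃ g, IsComplementary u g T (2 - T.card) := by
  have hT : T.card ≤ 2 := by simpa using T.card_le_univ
  obtain h | h | h : T.card = 0 ∨ T.card = 1 ∨ T.card = 2 := by omega
  · rw [h, Finset.card_eq_zero.1 h]
    exact ⟨fun p c => if p = c then 1 else 0, isComplementary_empty _ _ (by simp)⟩
  · obtain ⟨c, rfl⟩ := Finset.card_eq_one.1 h
    obtain ⟨w, hw, huw⟩ := exists_perp (col_ne_zero_of_det_ne_zero hu c)
    exact ⟨fun p _ => w p, isComplementary_singleton _ _ c (col_ne_zero_of_det_ne_zero hu c) hw huw⟩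
  · rw [h, (Finset.card_eq_iff_eq_univ T).1 (by simpa using h)]
    exact ⟨0, isComplementary_univ _ _ hu⟩

theorem exists_isComplementary_left {F : Type*} [Field F] (g : Fin 2 → Fin 2 → F)
    (hg : g 0 0 * g 1 1 - g 0 1 * g 1 0 ≠ 0) (k : ℕ) (hk : k ≤ 2) :
    ∃ u, (∀ p c : Fin 2, ¬ (c : ℕ) < 2 - k → u p c = 0) ∧
      IsComplementary u g (Finset.univ.filter fun c : Fin 2 => (c : ℕ) < 2 - k) k := by
  interval_cases k
  · refine ⟨fun p c => if p = c then 1 else 0, fun p c h => absurd c.is_lt h, ?_⟩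
    rw [Finset.filter_true_of_mem fun c _ => c.is_lt]
    exact isComplementary_univ _ _ (by simp)
  · obtain ⟨w, hw, hgw⟩ := exists_perp (col_ne_zero_of_det_ne_zero hg 0)
    refine ⟨fun p c => if c = 0 then w p else 0, fun p c h => if_neg ?_, ?_⟩
    · rintro rfl
      simp at h
    · rw [show (Finset.univ.filter fun c : Fin 2 => (c : ℕ) < 2 - 1) = {0} by decide]
      refine isComplementary_singleton _ _ 0 (by simpa using hw)
        (col_ne_zero_of_det_ne_zero hg 0) ?_
      simpa [mul_comm] using hgw
  · exact ⟨0, by simp, by simpa using isComplementary_empty _ _ hg⟩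

/-- `Z(y)` is nonsingular iff there is a half-integral `z ≥ y` with `|z| = n/2` (encoded by
`s : Fin m → ℕ` with `sᵢ = 2 zᵢ` and `∑ᵢ sᵢ = n`) such that the `2n × 2n` matrix `B(z)` is
nonsingular (i.e. has rank `2n`). -/
theorem Zmat_nonsingular_iff
    {K : Type*} [Field K] {n m : ℕ} (hn : 0 < n) (hm : 0 < m)
    (a b : Fin m → Fin n → K) (hab : ∀ i, LinearIndependent K ![a i, b i])
    (t : Fin m → ℕ) (ht : ∀ i, t i ≤ 2) :
    (Zmat a b t).det ≠ 0 ↔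
      ∃ s : Fin m → ℕ, (∀ i, s i ≤ 2) ∧ (∀ i, t i ≤ s i) ∧ (∑ i, s i) = n ∧
        (Bmat a b s).rank = 2 * n := by
  have hcols : ∀ s : Fin m → ℕ, (∀ i, s i ≤ 2) → ∑ i, s i = n →
      Nonempty (Fin 2 × Fin n ≃ {x : Fin m × Fin 2 × Fin 2 // (x.2.1 : ℕ) < s x.1}) := by
    intro s hs hsum
    refine ⟨Fintype.equivOfCardEq ?_⟩
    rw [card_columns s hs, hsum]
    simp
  have hrank : ∀ s : Fin m → ℕ,
      ∀ e : Fin 2 × Fin n ≃ {x : Fin m × Fin 2 × Fin 2 // (x.2.1 : ℕ) < s x.1},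
        (Bmat a b s).rank = 2 * n ↔
          ((Bmat a b s).submatrix id fun i => (e i : Fin m × Fin 2 × Fin 2)).det ≠ 0 := by
    intro s e
    rw [← rank_eq_card_iff_det_submatrix_ne_zero (Bmat a b s) (fun i x hx => if_neg hx) e]
    simp
  have hcardS : ∀ S : Finset (Fin m × Fin 2),
      S.card = ∑ i, (Finset.univ.filter fun c => (i, c) ∈ S).card := by
    intro S
    simp only [Finset.card_filter, ← Fintype.sum_prod_type']
    simp
  constructor
  · intro hdet
    rw [Zmat_eq_specialZ] at hdet
    obtain ⟨S, hSt, hcard, hS⟩ := exists_injective_of_det_specialZ_ne_zero _ _ _ _ _ hdet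
    set T : Fin m → Finset (Fin 2) := fun i => Finset.univ.filter fun c => (i, c) ∈ S with hTdef
    have hT : ∀ i c, (i, c) ∈ S ↔ c ∈ T i := by simp [T]
    have hT2 : ∀ i, (T i).card ≤ 2 := fun i => by simpa using (T i).card_le_univ
    choose g hg using fun i =>
      exists_isComplementary_right (Uvar i) (det_Uvar_ne_zero (K := K) i) (T i)
    have hs2 : ∀ i, 2 - (T i).card ≤ 2 := fun i => Nat.sub_le _ _
    have hsum : ∑ i, (2 - (T i).card) = n := by
      have h1 : ∑ i, (2 - (T i).card) + ∑ i, (T i).card = 2 * m := by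
        rw [← Finset.sum_add_distrib, Finset.sum_congr rfl fun i _ => Nat.sub_add_cancel (hT2 i)]
        simp [mul_comm]
      have h2 := hcardS S
      change S.card = ∑ i, (T i).card at h2
      omega
    obtain ⟨e⟩ := hcols _ hs2 hsum
    refine ⟨fun i => 2 - (T i).card, hs2, fun i => ?_, hsum, ?_⟩
    · have h1 : T i ⊆ Finset.univ.filter fun c : Fin 2 => (c : ℕ) < 2 - t i := by
        intro c hc
        simpa using hSt (i, c) ((hT i c).2 hc)
      have h2 := Finset.card_le_card h1
      have h3 : (Finset.univ.filter fun c : Fin 2 => (c : ℕ) < 2 - t i).card = 2 - t i := by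
        rw [Fin.card_filter_val_lt]
        omega
      have := ht i
      change t i ≤ 2 - (T i).card
      omega
    · rw [hrank _ e]
      apply det_Bmat_submatrix_ne_zero_of_specialization a b _ g
      rw [det_submatrix_ne_zero_iff_forall_supported _ e]
      exact (injective_iff_of_isComplementary _ hT hg a b).1 hS
  · rintro ⟨s, hs2, hts, hsum, hr⟩
    obtain ⟨e⟩ := hcols _ hs2 hsum
    rw [hrank _ e, det_submatrix_ne_zero_iff_forall_supported _ e, Bmat_eq_specialB] at hr
    choose u hu0 hu using fun i =>
      exists_isComplementary_left (Uvar i) (det_Uvar_ne_zero (K := K) i) (s i) (hs2 i)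
    let S : Finset (Fin m × Fin 2) := Finset.univ.filter fun e => (e.2 : ℕ) < 2 - s e.1
    have hmem : ∀ i c, (i, c) ∈ S ↔ (c : ℕ) < 2 - s i := by simp [S]
    refine det_Zmat_ne_zero_of_specialization a b t u
      (det_specialZ_ne_zero_of_injective _ u a b t S ?_ ?_ ?_
        ((injective_iff_of_isComplementary _ (fun i c => by simp [hmem]) hu a b).2 hr))
    · rintro ⟨i, c⟩ he
      exact ((hmem i c).1 he).trans_le (Nat.sub_le_sub_left (hts i) 2)
    · intro i p c hc
      exact hu0 i p c fun h => hc ((hmem i c).2 h)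
    · have h1 : S.card = ∑ i, (2 - s i) := by
        rw [hcardS]
        refine Finset.sum_congr rfl fun i _ => ?_
        simp only [hmem]
        rw [Fin.card_filter_val_lt]
        omega
      rw [h1, ← hsum, ← Finset.sum_add_distrib,
        Finset.sum_congr rfl fun i _ => Nat.sub_add_cancel (hs2 i)]
      simp [mul_comm]
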